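/- arXiv:2511.01703 — 2 statements merged into one kernel-verified Lean document; each statement's English description precedes it below -/
import Mathlib

section
/- Let n be a positive integer and let λ, ρ_1,…,ρ_n, β_1,…,β_n be positive real numbers. Define g(γ_1,…,γ_n) = (Σ_{i=1}^n γ_i^λ ρ_i)^{1/λ} · (Σ_{i=1}^n β_i/γ_i) for positive γ_1,…,γ_n. Then: (i) for every choice of positive γ_1,…,γ_n one has g(γ_1,…,γ_n) ≥ (Σ_{i=1}^n ρ_i^{1/(1+λ)} β_i^{λ/(1+λ)})^{(1+λ)/λ}; and (ii) for any c > 0, the choice γ_i = c (β_i/ρ_i)^{1/(1+λ)} attains this lower bound, i.e., g evaluated at these γ_i equals (Σ_{i=1}^n ρ_i^{1/(1+λ)} β_i^{λ/(1+λ)})^{(1+λ)/λ}. -/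
open Finset

/-- The Hölder factors built from `γ ^ lam * ρ` and `β / γ` multiply to a quantity free of `γ`. -/
lemma rpow_mul_rpow_weight_cancel {lam r b g : ℝ} (hr : 0 < r) (hb : 0 < b)
    (hg : 0 < g) :
    (g ^ lam * r) ^ (1 / (1 + lam)) * (b / g) ^ (lam / (1 + lam)) =
      r ^ (1 / (1 + lam)) * b ^ (lam / (1 + lam)) := by
  rw [Real.mul_rpow (by positivity) hr.le, ← Real.rpow_mul hg.le, Real.div_rpow hb.le hg.le,
    mul_one_div]
  field_simp

lemma optimal_weight_rpow_mul {lam r b c : ℝ} (hlam : 0 < lam) (hr : 0 < r) (hb : 0 < b)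
    (hc : 0 < c) :
    (c * (b / r) ^ (1 / (1 + lam))) ^ lam * r =
      c ^ lam * (r ^ (1 / (1 + lam)) * b ^ (lam / (1 + lam))) := by
  have hexp : 1 / (1 + lam) = 1 - lam / (1 + lam) := by field_simp; ring
  rw [Real.mul_rpow hc.le (by positivity), ← Real.rpow_mul (by positivity), one_div_mul_eq_div,
    Real.div_rpow hb.le hr.le, hexp, Real.rpow_sub hr, Real.rpow_one]
  ring

lemma div_optimal_weight {lam r b c : ℝ} (hlam : 0 < lam) (hr : 0 < r) (hb : 0 < b) :
    b / (c * (b / r) ^ (1 / (1 + lam))) =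
      c⁻¹ * (r ^ (1 / (1 + lam)) * b ^ (lam / (1 + lam))) := by
  have hexp : lam / (1 + lam) = 1 - 1 / (1 + lam) := by field_simp; ring
  rw [Real.div_rpow hb.le hr.le, hexp, Real.rpow_sub hb, Real.rpow_one]
  field_simp

/-- the weight-optimization lemma (Kuo–Schwab–Sloan, Lemma 6.2):
`g(γ) = (Σ γᵢ^λ ρᵢ)^{1/λ} (Σ βᵢ/γᵢ)` is bounded below by
`(Σ ρᵢ^{1/(1+λ)} βᵢ^{λ/(1+λ)})^{(1+λ)/λ}`, and the choice
`γᵢ = c (βᵢ/ρᵢ)^{1/(1+λ)}` attains this bound. -/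
theorem stmt2 (n : ℕ) (hn : 0 < n) (lam : ℝ) (hlam : 0 < lam)
    (ρ β : Fin n → ℝ) (hρ : ∀ i, 0 < ρ i) (hβ : ∀ i, 0 < β i) :
    (∀ γ : Fin n → ℝ, (∀ i, 0 < γ i) →
      (∑ i, (γ i) ^ lam * ρ i) ^ (1 / lam) * (∑ i, β i / γ i)
        ≥ (∑ i, (ρ i) ^ (1 / (1 + lam)) * (β i) ^ (lam / (1 + lam))) ^ ((1 + lam) / lam)) ∧
    (∀ c : ℝ, 0 < c →
      (∑ i, (c * (β i / ρ i) ^ (1 / (1 + lam))) ^ lam * ρ i) ^ (1 / lam)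
          * (∑ i, β i / (c * (β i / ρ i) ^ (1 / (1 + lam))))
        = (∑ i, (ρ i) ^ (1 / (1 + lam)) * (β i) ^ (lam / (1 + lam))) ^ ((1 + lam) / lam)) := by
  have hexp : (1 + lam) / lam = 1 / lam + 1 := by field_simp
  refine ⟨fun γ hγ => ?_, fun c hc => ?_⟩
  · have hpq : (1 + lam).HolderConjugate ((1 + lam) / lam) := by
      rw [Real.holderConjugate_iff]
      exact ⟨by linarith, by field_simp⟩
    have hA : ∀ i, 0 < γ i ^ lam * ρ i := fun i =>
      mul_pos (Real.rpow_pos_of_pos (hγ i) _) (hρ i)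
    have hB : ∀ i, 0 < β i / γ i := fun i => div_pos (hβ i) (hγ i)
    have hAs : 0 ≤ ∑ i, γ i ^ lam * ρ i := sum_nonneg fun i _ => (hA i).le
    have hBs : 0 ≤ ∑ i, β i / γ i := sum_nonneg fun i _ => (hB i).le
    have holder := Real.inner_le_Lp_mul_Lq_of_nonneg univ hpq
      (f := fun i => (γ i ^ lam * ρ i) ^ (1 / (1 + lam)))
      (g := fun i => (β i / γ i) ^ (lam / (1 + lam)))
      (fun i _ => Real.rpow_nonneg (hA i).le _) (fun i _ => Real.rpow_nonneg (hB i).le _)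
    have hf : ∀ i, ((γ i ^ lam * ρ i) ^ (1 / (1 + lam))) ^ (1 + lam) = γ i ^ lam * ρ i := by
      intro i
      rw [← Real.rpow_mul (hA i).le, one_div_mul_cancel (by positivity), Real.rpow_one]
    have hg : ∀ i, ((β i / γ i) ^ (lam / (1 + lam))) ^ ((1 + lam) / lam) = β i / γ i := by
      intro i
      rw [← Real.rpow_mul (hB i).le, div_mul_div_cancel₀ (by positivity), div_self hlam.ne',
        Real.rpow_one]
    simp only [rpow_mul_rpow_weight_cancel (hρ _) (hβ _) (hγ _), hf, hg] at holder
    calc _ ≤ ((∑ i, γ i ^ lam * ρ i) ^ (1 / (1 + lam)) *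
          (∑ i, β i / γ i) ^ (1 / ((1 + lam) / lam))) ^ ((1 + lam) / lam) :=
          Real.rpow_le_rpow (sum_nonneg fun i _ => mul_nonneg (Real.rpow_nonneg (hρ i).le _)
            (Real.rpow_nonneg (hβ i).le _)) holder (by positivity)
      _ = _ := by
          rw [Real.mul_rpow (Real.rpow_nonneg hAs _) (Real.rpow_nonneg hBs _),
            ← Real.rpow_mul hAs, ← Real.rpow_mul hBs, one_div_mul_cancel (by positivity),
            Real.rpow_one, div_mul_div_cancel₀ (by positivity)]
  · simp only [optimal_weight_rpow_mul hlam (hρ _) (hβ _) hc,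
      div_optimal_weight hlam (hρ _) (hβ _), ← mul_sum]
    have hS : 0 < ∑ i, ρ i ^ (1 / (1 + lam)) * β i ^ (lam / (1 + lam)) :=
      sum_pos (fun i _ => mul_pos (Real.rpow_pos_of_pos (hρ i) _) (Real.rpow_pos_of_pos (hβ i) _))
        ⟨⟨0, hn⟩, mem_univ _⟩
    rw [Real.mul_rpow (by positivity) hS.le, ← Real.rpow_mul hc.le, mul_one_div_cancel hlam.ne',
      Real.rpow_one, hexp, Real.rpow_add hS, Real.rpow_one]
    field_simp
end

section
/- Let Q and V be real inner product spaces, let a_min, a_max, β > 0 with a_min ≤ a_max, and let A : Q → Q be a linear map that is symmetric (⟪A r, r'⟫ = ⟪r, A r'⟫ for all r, r') and satisfies a_min ‖r‖² ≤ ⟪A r, r⟫ ≤ a_max ‖r‖² for all r ∈ Q. Let B : Q → V be a linear map satisfying the inf-sup condition: for every v ∈ V, β ‖v‖ ≤ sup_{0 ≠ r ∈ Q} ⟪B r, v⟫ / (‖r‖² + ‖B r‖²)^{1/2}. Let f ∈ V and suppose (q, u) ∈ Q × V satisfies the saddle-point system ⟪A q, r⟫ − ⟪u, B r⟫ = 0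 for all r ∈ Q and ⟪B q, v⟫ = ⟪f, v⟫ for all v ∈ V. Then, writing ‖q‖_A = ⟪A q, q⟫^{1/2}, one has (β/√a_max) ‖u‖ ≤ ‖q‖_A ≤ (√a_max/β) ‖f‖. -/
open RealInnerProductSpace

/-- Cauchy–Schwarz inequality for the semi-inner product induced by a symmetric positive
semidefinite operator. -/
theorem inner_map_sq_le_of_symmetric_of_nonneg {E : Type*} [NormedAddCommGroup E]
    [InnerProductSpace ℝ E] (T : E →ₗ[ℝ] E) (hT : ∀ x y : E, ⟪T x, y⟫ = ⟪x, T y⟫)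
    (hpos : ∀ x : E, 0 ≤ ⟪T x, x⟫) (x y : E) :
    ⟪T x, y⟫ ^ 2 ≤ ⟪T x, x⟫ * ⟪T y, y⟫ := by
  have h : discrim ⟪T y, y⟫ (2 * ⟪T x, y⟫) ⟪T x, x⟫ ≤ 0 := by
    refine discrim_le_zero fun t => ?_
    have ht := hpos (x + t • y)
    have hyx : ⟪T y, x⟫ = ⟪T x, y⟫ := by rw [hT, real_inner_comm]
    simp only [map_add, map_smul, inner_add_left, inner_add_right, real_inner_smul_left,
      real_inner_smul_right, hyx] at ht
    linarith
  unfold discrim at h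
  linarith

/-- abstract stability estimate for mixed finite element methods:
under symmetry and coercivity/boundedness of `A`, the inf-sup condition for `B`, and
the saddle-point equations, the energy norm `‖q‖_A = ⟪A q, q⟫^{1/2}` satisfies
`(β/√a_max) ‖u‖ ≤ ‖q‖_A ≤ (√a_max/β) ‖f‖`. -/
theorem stmt13 (Q V : Type*) [NormedAddCommGroup Q] [InnerProductSpace ℝ Q]
    [NormedAddCommGroup V] [InnerProductSpace ℝ V]
    (amin amax β : ℝ) (hamin : 0 < amin) (hamax : 0 < amax) (hβ : 0 < β)
    (hminmax : amin ≤ amax)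
    (A : Q →ₗ[ℝ] Q)
    (hsym : ∀ r r' : Q, ⟪A r, r'⟫ = ⟪r, A r'⟫)
    (hcoer : ∀ r : Q, amin * ‖r‖ ^ 2 ≤ ⟪A r, r⟫)
    (hbdd : ∀ r : Q, ⟪A r, r⟫ ≤ amax * ‖r‖ ^ 2)
    (B : Q →ₗ[ℝ] V)
    (hinfsup : ∀ v : V, β * ‖v‖
      ≤ ⨆ r : {r : Q // r ≠ 0}, ⟪B (r : Q), v⟫ / Real.sqrt (‖(r : Q)‖ ^ 2 + ‖B (r : Q)‖ ^ 2))
    (f : V) (q : Q) (u : V)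
    (heq1 : ∀ r : Q, ⟪A q, r⟫ - ⟪u, B r⟫ = 0)
    (heq2 : ∀ v : V, ⟪B q, v⟫ = ⟪f, v⟫) :
    (β / Real.sqrt amax) * ‖u‖ ≤ Real.sqrt ⟪A q, q⟫ ∧
    Real.sqrt ⟪A q, q⟫ ≤ (Real.sqrt amax / β) * ‖f‖ := by
  have hpos : ∀ r : Q, 0 ≤ ⟪A r, r⟫ := fun r => le_trans (by positivity) (hcoer r)
  have hu : β * ‖u‖ ≤ √amax * √⟪A q, q⟫ := by
    refine (hinfsup u).trans (Real.iSup_le (fun r => ?_) (by positivity))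
    refine div_le_of_le_mul₀ (by positivity) (by positivity) ?_
    have hBr : ⟪B (r : Q), u⟫ = ⟪A q, (r : Q)⟫ := by
      rw [real_inner_comm]
      linarith [heq1 r]
    rw [hBr, ← Real.sqrt_mul hamax.le, ← Real.sqrt_mul (mul_nonneg hamax.le (hpos q))]
    refine Real.le_sqrt_of_sq_le ?_
    calc ⟪A q, (r : Q)⟫ ^ 2 ≤ ⟪A q, q⟫ * ⟪A (r : Q), (r : Q)⟫ :=
          inner_map_sq_le_of_symmetric_of_nonneg A hsym hpos q r
      _ ≤ ⟪A q, q⟫ * (amax * (‖(r : Q)‖ ^ 2 + ‖B (r : Q)‖ ^ 2)) := by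
          refine mul_le_mul_of_nonneg_left ((hbdd r).trans ?_) (hpos q)
          gcongr
          exact le_add_of_nonneg_right (sq_nonneg _)
      _ = amax * ⟪A q, q⟫ * (‖(r : Q)‖ ^ 2 + ‖B (r : Q)‖ ^ 2) := by ring
  have hq : √⟪A q, q⟫ * √⟪A q, q⟫ ≤ ‖f‖ * ‖u‖ := by
    have h : ⟪A q, q⟫ = ⟪f, u⟫ := by
      rw [← heq2 u, real_inner_comm u]
      linarith [heq1 q]
    rw [Real.mul_self_sqrt (hpos q), h]
    exact real_inner_le_norm f u
  have hs : 0 < √amax := Real.sqrt_pos.2 hamax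
  constructor
  · rw [div_mul_eq_mul_div, div_le_iff₀ hs]
    linarith
  · rw [div_mul_eq_mul_div, le_div_iff₀ hβ]
    rcases (Real.sqrt_nonneg ⟪A q, q⟫).eq_or_lt with h0 | h0
    · rw [← h0, zero_mul]
      positivity
    · refine le_of_mul_le_mul_right ?_ h0
      calc √⟪A q, q⟫ * β * √⟪A q, q⟫ = β * (√⟪A q, q⟫ * √⟪A q, q⟫) := by ring
        _ ≤ β * (‖f‖ * ‖u‖) := by gcongr
        _ = ‖f‖ * (β * ‖u‖) := by ring
        _ ≤ ‖f‖ * (√amax * √⟪A q, q⟫) := by gcongr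
        _ = √amax * ‖f‖ * √⟪A q, q⟫ := by ring
end
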